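/- There exists a constant k > 0 such that |S(x,y)| ≤ k for all (x,y) ∈ Ω × Ω; that is, the kernel S(x,y) = E_{(c,w,b)∼ρ}[F_{c,w,b}(x)·F_{c,w,b}(y)] is uniformly bounded on Ω × Ω. -/

import Mathlib

open MeasureTheory

noncomputable section

/-- Partial derivative of `f : ℝ^d → ℝ` in coordinate direction `i`. -/
def pd {d : ℕ} (i : Fin d) (f : (Fin d → ℝ) → ℝ) : (Fin d → ℝ) → ℝ :=
  fun x => fderiv ℝ f x (Pi.single i 1)

/-- `Σ_{|α| ≤ 2} |D^α f₁ (x) - D^α f₂ (x)|`. -/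
def derivDiffSum2 {d : ℕ} (f₁ f₂ : (Fin d → ℝ) → ℝ) (x : Fin d → ℝ) : ℝ :=
  |f₁ x - f₂ x| + (∑ i, |pd i f₁ x - pd i f₂ x|) +
    ∑ i, ∑ j, |pd i (pd j f₁) x - pd i (pd j f₂) x|

/-- Euclidean inner product on the parameter space `ℝ^{d+2} = ℝ × ℝ^d × ℝ`. -/
def pdot {d : ℕ} (a b : ℝ × (Fin d → ℝ) × ℝ) : ℝ :=
  a.1 * b.1 + (∑ k, a.2.1 k * b.2.1 k) + a.2.2 * b.2.2

/-- Feature vector `F_{c,w,b}(x) = ∇_{c,w,b} 𝒜[η · c σ_{w,b}](x)`, written out explicitly: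
`(𝒜[η σ_{w,b}](x), (𝒜[c η xᵢ σ'_{w,b}](x))ᵢ, 𝒜[c η σ'_{w,b}](x))`. -/
def feat {d : ℕ} (A : ((Fin d → ℝ) → ℝ) → (Fin d → ℝ) → ℝ)
    (η : (Fin d → ℝ) → ℝ) (σ : ℝ → ℝ)
    (p : ℝ × (Fin d → ℝ) × ℝ) (x : Fin d → ℝ) : ℝ × (Fin d → ℝ) × ℝ :=
  (A (fun z => η z * σ (∑ k, p.2.1 k * z k + p.2.2)) x,
   fun i => A (fun z => p.1 * η z * z i * deriv σ (∑ k, p.2.1 k * z k + p.2.2)) x,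
   A (fun z => p.1 * η z * deriv σ (∑ k, p.2.1 k * z k + p.2.2)) x)

/-- The kernel `S(x,y) = E_{(c,w,b) ∼ ρ}[F_{c,w,b}(x) · F_{c,w,b}(y)]`. -/
def Skernel {d : ℕ} (A : ((Fin d → ℝ) → ℝ) → (Fin d → ℝ) → ℝ)
    (η : (Fin d → ℝ) → ℝ) (σ : ℝ → ℝ)
    (ρ : Measure (ℝ × (Fin d → ℝ) × ℝ)) (x y : Fin d → ℝ) : ℝ :=
  ∫ p, pdot (feat A η σ p x) (feat A η σ p y) ∂ρ

/-- Product rule for `f · s(w·z + b)` in a coordinate direction. -/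
lemma pd_mul_ridge {d : ℕ} (i : Fin d) (f : (Fin d → ℝ) → ℝ) (s : ℝ → ℝ)
    (hf : Differentiable ℝ f) (hs : Differentiable ℝ s) (w : Fin d → ℝ) (b : ℝ) :
    pd i (fun z => f z * s (∑ k, w k * z k + b)) =
      fun z => pd i f z * s (∑ k, w k * z k + b) +
        w i * (f z * deriv s (∑ k, w k * z k + b)) := by
  funext z
  have hL : HasFDerivAt (fun z : Fin d → ℝ => ∑ k, w k * z k + b)
      (∑ k, w k • (ContinuousLinearMap.proj k : (Fin d → ℝ) →L[ℝ] ℝ)) z :=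
    (HasFDerivAt.fun_sum fun k _ => (hasFDerivAt_apply k z).const_mul (w k)).add_const b
  have hc := (hs (∑ k, w k * z k + b)).hasDerivAt.comp_hasFDerivAt z hL
  have hm := (hf z).hasFDerivAt.mul hc
  have hL1 : (∑ k, w k • (ContinuousLinearMap.proj k : (Fin d → ℝ) →L[ℝ] ℝ))
      (Pi.single i 1) = w i := by
    simp [Pi.single_apply]
  have hfd : fderiv ℝ (fun z => f z * s (∑ k, w k * z k + b)) z = _ := hm.fderiv
  simp only [pd, hfd, add_apply, smul_apply, hL1,
    smul_eq_mul, Function.comp_apply]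
  ring

lemma pd_add {d : ℕ} (i : Fin d) (f g : (Fin d → ℝ) → ℝ)
    (hf : Differentiable ℝ f) (hg : Differentiable ℝ g) :
    pd i (fun z => f z + g z) = fun z => pd i f z + pd i g z := by
  funext z
  simp only [pd]
  rw [fderiv_fun_add (hf z) (hg z)]
  rfl

lemma pd_const_mul {d : ℕ} (i : Fin d) (c : ℝ) (f : (Fin d → ℝ) → ℝ)
    (hf : Differentiable ℝ f) :
    pd i (fun z => c * f z) = fun z => c * pd i f z := by
  funext z
  simp only [pd]
  rw [fderiv_const_mul (hf z)]
  rfl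

lemma pd_zero {d : ℕ} (i : Fin d) : pd i (0 : (Fin d → ℝ) → ℝ) = 0 := by
  funext z
  simp [pd]

lemma contDiff_pd {d : ℕ} {m n : WithTop ℕ∞} (i : Fin d) {f : (Fin d → ℝ) → ℝ}
    (hf : ContDiff ℝ n f) (hmn : m + 1 ≤ n) : ContDiff ℝ m (pd i f) :=
  (hf.fderiv_right hmn).clm_apply contDiff_const

lemma differentiable_ridge {d : ℕ} {s : ℝ → ℝ} (hs : Differentiable ℝ s)
    (w : Fin d → ℝ) (b : ℝ) :
    Differentiable ℝ fun z : Fin d → ℝ => s (∑ k, w k * z k + b) :=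
  hs.comp (by fun_prop)

/-- Second-order product rule for `h · s(w·z + b)`. -/
lemma pd_pd_mul_ridge {d : ℕ} (i j : Fin d) (h : (Fin d → ℝ) → ℝ) (s : ℝ → ℝ)
    (hh : ContDiff ℝ 2 h) (hs : ContDiff ℝ 2 s) (w : Fin d → ℝ) (b : ℝ) (z : Fin d → ℝ) :
    pd i (pd j fun z => h z * s (∑ k, w k * z k + b)) z =
      pd i (pd j h) z * s (∑ k, w k * z k + b) +
        w i * (pd j h z * deriv s (∑ k, w k * z k + b)) +
        w j * (pd i h z * deriv s (∑ k, w k * z k + b) +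
          w i * (h z * deriv (deriv s) (∑ k, w k * z k + b))) := by
  have hh1 : Differentiable ℝ h := hh.differentiable (by norm_num)
  have hs1 : Differentiable ℝ s := hs.differentiable (by norm_num)
  have hds : Differentiable ℝ (deriv s) :=
    ((contDiff_succ_iff_deriv (n := 1)).1 hs).2.2.differentiable (by norm_num)
  have hdh : Differentiable ℝ (pd j h) :=
    (contDiff_pd (m := 1) j hh (by norm_num)).differentiable (by norm_num)
  have h1 := hdh.fun_mul (differentiable_ridge hs1 w b)
  have h2 := hh1.fun_mul (differentiable_ridge hds w b)
  rw [pd_mul_ridge j h s hh1 hs1, pd_add i _ _ h1 (h2.const_mul (w j)), pd_const_mul i _ _ h2,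
    pd_mul_ridge i _ s hdh hs1, pd_mul_ridge i h _ hh1 hds]

lemma abs_mul_le_of_le {a b H B : ℝ} (ha : |a| ≤ H) (hb : |b| ≤ B) : |a * b| ≤ H * B := by
  rw [abs_mul]
  exact mul_le_mul ha hb (abs_nonneg _) ((abs_nonneg _).trans ha)

/-- The second-order size of `h · s(w·z + b)` grows at most quadratically in the weights `w`. -/
lemma derivDiffSum2_mul_ridge_le {d : ℕ} (h : (Fin d → ℝ) → ℝ) (s : ℝ → ℝ)
    (hh : ContDiff ℝ 2 h) (hs : ContDiff ℝ 2 s) (w : Fin d → ℝ) (b : ℝ) (x : Fin d → ℝ)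
    (H B : ℝ) (hH0 : |h x| ≤ H) (hH1 : ∀ i, |pd i h x| ≤ H)
    (hH2 : ∀ i j, |pd i (pd j h) x| ≤ H)
    (hB0 : ∀ r, |s r| ≤ B) (hB1 : ∀ r, |deriv s r| ≤ B) (hB2 : ∀ r, |deriv (deriv s) r| ≤ B) :
    derivDiffSum2 (fun z => h z * s (∑ k, w k * z k + b)) 0 x ≤
      2 * (1 + d) ^ 2 * (H * B) *
        (1 + (∑ i, |w i|) + ∑ i, ∑ j, |w i * w j|) := by
  have hH : 0 ≤ H := (abs_nonneg _).trans hH0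
  have hB : 0 ≤ B := (abs_nonneg _).trans (hB0 0)
  have hHB : 0 ≤ H * B := mul_nonneg hH hB
  have e1 : ∀ i, |pd i (fun z => h z * s (∑ k, w k * z k + b)) x - pd i 0 x| ≤
      H * B * (1 + |w i|) := by
    intro i
    rw [pd_mul_ridge i h s (hh.differentiable (by norm_num)) (hs.differentiable (by norm_num)),
      pd_zero, Pi.zero_apply, sub_zero]
    have t1 := abs_mul_le_of_le (hH1 i) (hB0 (∑ k, w k * x k + b))
    have t2 := abs_mul_le_of_le (le_refl |w i|)
      (abs_mul_le_of_le hH0 (hB1 (∑ k, w k * x k + b)))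
    refine (abs_add_le _ _).trans ?_
    linarith
  have e2 : ∀ i j, |pd i (pd j fun z => h z * s (∑ k, w k * z k + b)) x - pd i (pd j 0) x| ≤
      H * B * (1 + |w i| + |w j| + |w i * w j|) := by
    intro i j
    rw [pd_pd_mul_ridge i j h s hh hs, pd_zero, pd_zero, Pi.zero_apply, sub_zero, mul_add,
      ← mul_assoc (w j) (w i), ← add_assoc, mul_comm (w j) (w i)]
    have t1 := abs_mul_le_of_le (hH2 i j) (hB0 (∑ k, w k * x k + b))
    have t2 := abs_mul_le_of_le (le_refl |w i|)
      (abs_mul_le_of_le (hH1 j) (hB1 (∑ k, w k * x k + b)))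
    have t3 := abs_mul_le_of_le (le_refl |w j|)
      (abs_mul_le_of_le (hH1 i) (hB1 (∑ k, w k * x k + b)))
    have t4 := abs_mul_le_of_le (le_refl |w i * w j|)
      (abs_mul_le_of_le hH0 (hB2 (∑ k, w k * x k + b)))
    refine (abs_add_le _ _).trans ?_
    refine (add_le_add_left ((abs_add_le _ _).trans
      (add_le_add_left (abs_add_le _ _) _)) _).trans ?_
    linarith
  have e0 : |h x * s (∑ k, w k * x k + b) - 0| ≤ H * B := by
    rw [sub_zero]
    exact abs_mul_le_of_le hH0 (hB0 _)
  have s1 := Finset.sum_le_sum fun i (_ : i ∈ Finset.univ) => e1 i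
  have s2 := Finset.sum_le_sum fun i (_ : i ∈ Finset.univ) =>
    Finset.sum_le_sum fun j (_ : j ∈ Finset.univ) => e2 i j
  simp only [← Finset.mul_sum, Finset.sum_add_distrib, Finset.sum_const, Finset.card_univ,
    Fintype.card_fin, nsmul_eq_mul, mul_one] at s1 s2
  have hS : 0 ≤ ∑ i, |w i| := Finset.sum_nonneg fun i _ => abs_nonneg _
  have hT : 0 ≤ ∑ i, ∑ j, |w i * w j| :=
    Finset.sum_nonneg fun i _ => Finset.sum_nonneg fun j _ => abs_nonneg _
  have hd : (0 : ℝ) ≤ d := Nat.cast_nonneg d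
  simp only [derivDiffSum2, Pi.zero_apply]
  refine (add_le_add (add_le_add e0 s1) s2).trans ?_
  generalize (∑ i, |w i|) = S at *
  generalize (∑ i, ∑ j, |w i * w j|) = T at *
  have key : 1 + (d + S) + (d * d + d * S + d * S + T) ≤ 2 * (1 + (d : ℝ)) ^ 2 * (1 + S + T) := by
    nlinarith [mul_nonneg hd hS, mul_nonneg hd hT, mul_nonneg (mul_nonneg hd hd) hS,
      mul_nonneg (mul_nonneg hd hd) hT]
  calc _ = H * B * (1 + (d + S) + (d * d + d * S + d * S + T)) := by ring
    _ ≤ H * B * (2 * (1 + (d : ℝ)) ^ 2 * (1 + S + T)) := mul_le_mul_of_nonneg_left key hHB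
    _ = _ := by ring

/-- A `C²` function has bounded derivatives up to order two on a compact set. -/
lemma exists_bound_pd_of_isCompact {d : ℕ} {Ω : Set (Fin d → ℝ)} (hΩ : IsCompact Ω)
    {h : (Fin d → ℝ) → ℝ} (hh : ContDiff ℝ 2 h) :
    ∃ H : ℝ, ∀ x ∈ Ω, |h x| ≤ H ∧ (∀ i, |pd i h x| ≤ H) ∧ ∀ i j, |pd i (pd j h) x| ≤ H := by
  have c1 : ∀ i, ContDiff ℝ 1 (pd i h) := fun i => contDiff_pd i hh (by norm_num)
  have c2 : ∀ i j, ContDiff ℝ 0 (pd i (pd j h)) := fun i j =>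
    contDiff_pd i (c1 j) (by norm_num)
  obtain ⟨H0, h0⟩ := hΩ.exists_bound_of_continuousOn hh.continuous.continuousOn
  choose H1 h1 using fun i => hΩ.exists_bound_of_continuousOn (c1 i).continuous.continuousOn
  choose H2 h2 using fun i j => hΩ.exists_bound_of_continuousOn (c2 i j).continuous.continuousOn
  simp only [Real.norm_eq_abs] at h0 h1 h2
  refine ⟨|H0| + ∑ i, |H1 i| + ∑ i, ∑ j, |H2 i j|, fun x hx => ?_⟩
  have n1 : 0 ≤ ∑ i, |H1 i| := Finset.sum_nonneg fun i _ => abs_nonneg _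
  have n2 : ∀ i, 0 ≤ ∑ j, |H2 i j| := fun i => Finset.sum_nonneg fun j _ => abs_nonneg _
  have n3 : 0 ≤ ∑ i, ∑ j, |H2 i j| := Finset.sum_nonneg fun i _ => n2 i
  refine ⟨?_, fun i => ?_, fun i j => ?_⟩
  · linarith [h0 x hx, le_abs_self H0]
  · linarith [h1 i x hx, le_abs_self (H1 i), abs_nonneg H0,
      Finset.single_le_sum (f := fun i => |H1 i|) (fun i _ => abs_nonneg _) (Finset.mem_univ i)]
  · linarith [h2 i j x hx, le_abs_self (H2 i j), abs_nonneg H0,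
      Finset.single_le_sum (f := fun j => |H2 i j|) (fun j _ => abs_nonneg _) (Finset.mem_univ j),
      Finset.single_le_sum (f := fun i => ∑ j, |H2 i j|) (fun i _ => n2 i) (Finset.mem_univ i)]

/-- An operator that is homogeneous and pointwise Lipschitz in the 2-jet sends the ridge-type
functions `h · s(w·z + b)` to functions growing at most quadratically in `w`, uniformly on `Ω`. -/
lemma exists_bound_operator_mul_ridge {d : ℕ} {Ω : Set (Fin d → ℝ)} (hΩ : IsCompact Ω)
    (A : ((Fin d → ℝ) → ℝ) → (Fin d → ℝ) → ℝ)
    (hAsmul : ∀ (c : ℝ) (f : (Fin d → ℝ) → ℝ), A (c • f) = c • A f)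
    (k₀ : ℝ) (hk₀ : 0 < k₀)
    (hALip : ∀ f₁ f₂ : (Fin d → ℝ) → ℝ, ContDiff ℝ 2 f₁ → ContDiff ℝ 2 f₂ →
      ∀ x ∈ Ω, |A f₁ x - A f₂ x| ≤ k₀ * derivDiffSum2 f₁ f₂ x)
    {h : (Fin d → ℝ) → ℝ} {s : ℝ → ℝ} (hh : ContDiff ℝ 2 h) (hs : ContDiff ℝ 2 s)
    (hsbd : ∀ n : ℕ, n ≤ 2 → ∃ C : ℝ, ∀ r : ℝ, |iteratedDeriv n s r| ≤ C) :
    ∃ M : ℝ, 0 ≤ M ∧ ∀ (w : Fin d → ℝ) (b : ℝ), ∀ x ∈ Ω,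
      |A (fun z => h z * s (∑ k, w k * z k + b)) x| ≤
        M * (1 + (∑ i, |w i|) + ∑ i, ∑ j, |w i * w j|) := by
  obtain ⟨H, hH⟩ := exists_bound_pd_of_isCompact hΩ hh
  obtain ⟨B0, hB0⟩ := hsbd 0 (by norm_num)
  obtain ⟨B1, hB1⟩ := hsbd 1 (by norm_num)
  obtain ⟨B2, hB2⟩ := hsbd 2 le_rfl
  simp only [iteratedDeriv_zero] at hB0
  simp only [iteratedDeriv_one] at hB1
  simp only [iteratedDeriv_succ, iteratedDeriv_zero] at hB2
  have hA0 : A 0 = 0 := by simpa using hAsmul 0 0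
  set B := max B0 (max B1 B2)
  refine ⟨|k₀ * (2 * (1 + d) ^ 2 * (H * B))|, abs_nonneg _, fun w b x hx => ?_⟩
  obtain ⟨hH0, hH1, hH2⟩ := hH x hx
  have hlin : ContDiff ℝ 2 fun z : Fin d → ℝ => ∑ k, w k * z k + b := by fun_prop
  have hf : ContDiff ℝ 2 fun z => h z * s (∑ k, w k * z k + b) := hh.mul (hs.comp hlin)
  have hL := hALip _ 0 hf contDiff_const x hx
  rw [hA0, Pi.zero_apply, sub_zero] at hL
  have hD := derivDiffSum2_mul_ridge_le h s hh hs w b x H B hH0 hH1 hH2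
    (fun r => (hB0 r).trans (le_max_left _ _))
    (fun r => (hB1 r).trans ((le_max_left _ _).trans (le_max_right _ _)))
    (fun r => (hB2 r).trans ((le_max_right _ _).trans (le_max_right _ _)))
  have hW : 0 ≤ 1 + (∑ i, |w i|) + ∑ i, ∑ j, |w i * w j| := by positivity
  refine hL.trans ((mul_le_mul_of_nonneg_left hD hk₀.le).trans ?_)
  rw [← mul_assoc]
  exact mul_le_mul_of_nonneg_right (le_abs_self _) hW

lemma abs_pdot_le {d : ℕ} {a b : ℝ × (Fin d → ℝ) × ℝ} {R : ℝ}
    (ha1 : |a.1| ≤ R) (ha2 : ∀ i, |a.2.1 i| ≤ R) (ha3 : |a.2.2| ≤ R)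
    (hb1 : |b.1| ≤ R) (hb2 : ∀ i, |b.2.1 i| ≤ R) (hb3 : |b.2.2| ≤ R) :
    |pdot a b| ≤ (d + 2) * (R * R) := by
  have hs : |∑ k, a.2.1 k * b.2.1 k| ≤ d * (R * R) := by
    refine (Finset.abs_sum_le_sum_abs _ _).trans ?_
    refine (Finset.sum_le_sum fun k _ => abs_mul_le_of_le (ha2 k) (hb2 k)).trans ?_
    simp
  have h1 := abs_mul_le_of_le ha1 hb1
  have h3 := abs_mul_le_of_le ha3 hb3
  refine (abs_add_le _ _).trans ((add_le_add_left (abs_add_le _ _) _).trans ?_)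
  linarith

/-- Lemma 4.3 of the paper: the kernel `S` is uniformly bounded on `Ω × Ω`. -/
theorem kernel_S_uniformly_bounded
    {d : ℕ}
    (Ω : Set (Fin d → ℝ)) (hΩ : IsCompact Ω)
    (μ : Measure (Fin d → ℝ)) [IsFiniteMeasure μ]
    (A : ((Fin d → ℝ) → ℝ) → (Fin d → ℝ) → ℝ)
    (hAadd : ∀ f g : (Fin d → ℝ) → ℝ, A (f + g) = A f + A g)
    (hAsmul : ∀ (c : ℝ) (f : (Fin d → ℝ) → ℝ), A (c • f) = c • A f)
    (k₀ : ℝ) (hk₀ : 0 < k₀)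
    (hALip : ∀ f₁ f₂ : (Fin d → ℝ) → ℝ, ContDiff ℝ 2 f₁ → ContDiff ℝ 2 f₂ →
      ∀ x ∈ Ω, |A f₁ x - A f₂ x| ≤ k₀ * derivDiffSum2 f₁ f₂ x)
    (σ : ℝ → ℝ) (hσ : ContDiff ℝ 4 σ) (hσnc : ∃ a b : ℝ, σ a ≠ σ b)
    (hσbd : ∀ n : ℕ, n ≤ 4 → ∃ C : ℝ, ∀ r : ℝ, |iteratedDeriv n σ r| ≤ C)
    (η : (Fin d → ℝ) → ℝ) (hη : ContDiff ℝ 3 η)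
    (hηbd : ∀ n : ℕ, n ≤ 3 → ∃ C : ℝ, ∀ z : Fin d → ℝ, ‖iteratedFDeriv ℝ n η z‖ ≤ C)
    (hηbdry : ∀ z ∈ frontier Ω, η z = 0)
    (ρ : Measure (ℝ × (Fin d → ℝ) × ℝ)) [IsProbabilityMeasure ρ]
    (K₀ : ℝ) (hc_bd : ∀ᵐ p ∂ρ, |p.1| ≤ K₀)
    (hc_mean : ∫ p, p.1 ∂ρ = 0)
    (hmom : Integrable
      (fun p : ℝ × (Fin d → ℝ) × ℝ =>
        (1 + (∑ i, |p.2.1 i|) + ∑ i, ∑ j, |p.2.1 i * p.2.1 j|) ^ 2) ρ) :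
    ∃ k : ℝ, 0 < k ∧ ∀ x ∈ Ω, ∀ y ∈ Ω, |Skernel A η σ ρ x y| ≤ k := by
  have hη2 : ContDiff ℝ 2 η := hη.of_le (by norm_num)
  have hσ2 : ContDiff ℝ 2 σ := hσ.of_le (by norm_num)
  have hdσ : ContDiff ℝ 3 (deriv σ) := ((contDiff_succ_iff_deriv (n := 3)).1 hσ).2.2
  have hdσ2 : ContDiff ℝ 2 (deriv σ) := hdσ.of_le (by norm_num)
  have hdσbd : ∀ n : ℕ, n ≤ 2 → ∃ C : ℝ, ∀ r : ℝ, |iteratedDeriv n (deriv σ) r| ≤ C := by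
    intro n hn
    simpa only [iteratedDeriv_succ'] using hσbd (n + 1) (by omega)
  obtain ⟨M1, hM1, h1⟩ := exists_bound_operator_mul_ridge hΩ A hAsmul k₀ hk₀ hALip hη2 hσ2
    fun n hn => hσbd n (by omega)
  obtain ⟨M3, hM3, h3⟩ := exists_bound_operator_mul_ridge hΩ A hAsmul k₀ hk₀ hALip hη2 hdσ2 hdσbd
  have hηx : ∀ i : Fin d, ContDiff ℝ 2 fun z : Fin d → ℝ => η z * z i := fun i =>
    hη2.mul (contDiff_apply ℝ ℝ i)
  choose M2 hM2 h2 using fun i =>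
    exists_bound_operator_mul_ridge hΩ A hAsmul k₀ hk₀ hALip (hηx i) hdσ2 hdσbd
  set M := M1 + |K₀| * ((∑ i, M2 i) + M3)
  have hM2s : 0 ≤ ∑ i, M2 i := Finset.sum_nonneg fun i _ => hM2 i
  have hM : 0 ≤ M := by positivity
  have hfeat : ∀ p : ℝ × (Fin d → ℝ) × ℝ, |p.1| ≤ K₀ → ∀ x ∈ Ω,
      |(feat A η σ p x).1| ≤ M * (1 + (∑ i, |p.2.1 i|) + ∑ i, ∑ j, |p.2.1 i * p.2.1 j|) ∧
      (∀ i, |(feat A η σ p x).2.1 i| ≤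
        M * (1 + (∑ i, |p.2.1 i|) + ∑ i, ∑ j, |p.2.1 i * p.2.1 j|)) ∧
      |(feat A η σ p x).2.2| ≤
        M * (1 + (∑ i, |p.2.1 i|) + ∑ i, ∑ j, |p.2.1 i * p.2.1 j|) := by
    intro p hp x hx
    have hW : 0 ≤ 1 + (∑ i, |p.2.1 i|) + ∑ i, ∑ j, |p.2.1 i * p.2.1 j| := by positivity
    have hp' : |p.1| ≤ |K₀| := hp.trans (le_abs_self _)
    refine ⟨(h1 p.2.1 p.2.2 x hx).trans (mul_le_mul_of_nonneg_right ?_ hW), fun i => ?_, ?_⟩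
    · exact le_add_of_nonneg_right (by positivity)
    · have e : (fun z : Fin d → ℝ => p.1 * η z * z i * deriv σ (∑ k, p.2.1 k * z k + p.2.2)) =
          p.1 • fun z : Fin d → ℝ => η z * z i * deriv σ (∑ k, p.2.1 k * z k + p.2.2) := by
        funext z
        simp only [Pi.smul_apply, smul_eq_mul]
        ring
      simp only [feat]
      rw [e, hAsmul, Pi.smul_apply, smul_eq_mul]
      refine (abs_mul_le_of_le hp' (h2 i p.2.1 p.2.2 x hx)).trans ?_
      rw [← mul_assoc]
      refine mul_le_mul_of_nonneg_right ?_ hW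
      have hi : M2 i ≤ (∑ i, M2 i) + M3 := (Finset.single_le_sum (f := M2)
        (fun i _ => hM2 i) (Finset.mem_univ i)).trans (le_add_of_nonneg_right hM3)
      exact (mul_le_mul_of_nonneg_left hi (abs_nonneg K₀)).trans (le_add_of_nonneg_left hM1)
    · have e : (fun z : Fin d → ℝ => p.1 * η z * deriv σ (∑ k, p.2.1 k * z k + p.2.2)) =
          p.1 • fun z : Fin d → ℝ => η z * deriv σ (∑ k, p.2.1 k * z k + p.2.2) := by
        funext z
        simp only [Pi.smul_apply, smul_eq_mul]
        ring
      simp only [feat]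
      rw [e, hAsmul, Pi.smul_apply, smul_eq_mul]
      refine (abs_mul_le_of_le hp' (h3 p.2.1 p.2.2 x hx)).trans ?_
      rw [← mul_assoc]
      refine mul_le_mul_of_nonneg_right ?_ hW
      exact (mul_le_mul_of_nonneg_left (le_add_of_nonneg_left hM2s) (abs_nonneg K₀)).trans
        (le_add_of_nonneg_left hM1)
  have hbound := hmom.const_mul ((d + 2) * M ^ 2)
  refine ⟨|∫ p, (d + 2) * M ^ 2 *
    (1 + (∑ i, |p.2.1 i|) + ∑ i, ∑ j, |p.2.1 i * p.2.1 j|) ^ 2 ∂ρ| + 1, by positivity, ?_⟩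
  intro x hx y hy
  have hpt : ∀ᵐ p ∂ρ, ‖pdot (feat A η σ p x) (feat A η σ p y)‖ ≤ (d + 2) * M ^ 2 *
      (1 + (∑ i, |p.2.1 i|) + ∑ i, ∑ j, |p.2.1 i * p.2.1 j|) ^ 2 := by
    filter_upwards [hc_bd] with p hp
    obtain ⟨a1, a2, a3⟩ := hfeat p hp x hx
    obtain ⟨b1, b2, b3⟩ := hfeat p hp y hy
    refine (abs_pdot_le a1 a2 a3 b1 b2 b3).trans (le_of_eq ?_)
    ring
  exact (norm_integral_le_of_norm_le hbound hpt).trans ((le_abs_self _).trans (le_add_of_nonneg_right zero_le_one))
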